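/- Let p ∈ (0,1), q = 1 − p, h = −p log p − q log q, and let (S_n, K_n)_{n≥0} be a random trie pair family with parameter p. Let f̃₀₁(z) = e^{−z} Σ_{n≥0} E(K_n) zⁿ/n! be the Poisson generating function of the mean external path length. Then f̃₀₁(x)/(x log x) → 1/h as x → ∞ along the positive reals, and likewise E(K_n)/(n log n) → 1/h as n → ∞. -/

import Mathlib

open MeasureTheory ProbabilityTheory Filter Topology

noncomputable def binomialMeasure (n : ℕ) (p : ℝ) : Measure ℕ :=
  ∑ k ∈ Finset.range (n + 1),
    (ENNReal.ofReal ((n.choose k : ℝ) * p ^ k * (1 - p) ^ (n - k))) • Measure.dirac k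

/-- The combination map `(B, (S',K')_j, (S'',K'')_j) ↦ (S'_B + S''_{n-B} + 1, K'_B + K''_{n-B} + n)`. -/
def trieStep (n : ℕ) (ω : ℕ × ((ℕ → ℕ × ℕ) × (ℕ → ℕ × ℕ))) : ℕ × ℕ :=
  ((ω.2.1 ω.1).1 + (ω.2.2 (n - ω.1)).1 + 1,
   (ω.2.1 ω.1).2 + (ω.2.2 (n - ω.1)).2 + n)

/-- A random trie pair family with parameter `p`, given by the joint laws
`μ n` of `(S_n, K_n)` on `ℕ × ℕ`. -/
structure IsTriePairFamily (p : ℝ) (μ : ℕ → Measure (ℕ × ℕ)) : Prop where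
  prob : ∀ n, IsProbabilityMeasure (μ n)
  moments : ∀ n r : ℕ, Integrable (fun x : ℕ × ℕ => ((x.1 : ℝ) + (x.2 : ℝ)) ^ r) (μ n)
  init0 : μ 0 = Measure.dirac (0, 0)
  init1 : μ 1 = Measure.dirac (0, 0)
  recur : ∀ n, 2 ≤ n → ∃ P : Measure (ℕ × ((ℕ → ℕ × ℕ) × (ℕ → ℕ × ℕ))),
    IsProbabilityMeasure P ∧
    P.map Prod.fst = binomialMeasure n p ∧
    (∀ j, P.map (fun ω => ω.2.1 j) = μ j) ∧
    (∀ j, P.map (fun ω => ω.2.2 j) = μ j) ∧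
    P = (P.map Prod.fst).prod
          ((P.map (fun ω => ω.2.1)).prod (P.map (fun ω => ω.2.2))) ∧
    μ n = P.map (trieStep n)

noncomputable def eS (μ : ℕ → Measure (ℕ × ℕ)) (n : ℕ) : ℝ := ∫ x, (x.1 : ℝ) ∂ μ n

noncomputable def eK (μ : ℕ → Measure (ℕ × ℕ)) (n : ℕ) : ℝ := ∫ x, (x.2 : ℝ) ∂ μ n

noncomputable def varS (μ : ℕ → Measure (ℕ × ℕ)) (n : ℕ) : ℝ :=
  ∫ x, ((x.1 : ℝ) - eS μ n) ^ 2 ∂ μ n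

noncomputable def varK (μ : ℕ → Measure (ℕ × ℕ)) (n : ℕ) : ℝ :=
  ∫ x, ((x.2 : ℝ) - eK μ n) ^ 2 ∂ μ n

noncomputable def covSK (μ : ℕ → Measure (ℕ × ℕ)) (n : ℕ) : ℝ :=
  ∫ x, ((x.1 : ℝ) - eS μ n) * ((x.2 : ℝ) - eK μ n) ∂ μ n

/-- The probability that a binomial variable with parameters `n` and `p` equals `k`. -/
noncomputable def binomialWeight (p : ℝ) (n k : ℕ) : ℝ :=
  (n.choose k : ℝ) * p ^ k * (1 - p) ^ (n - k)

theorem binomialWeight_nonneg {p : ℝ} (hp0 : 0 ≤ p) (hp1 : p ≤ 1) (n k : ℕ) :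
    0 ≤ binomialWeight p n k := by
  have : 0 ≤ 1 - p := by linarith
  unfold binomialWeight
  positivity

theorem lintegral_binomialMeasure (n : ℕ) (p : ℝ) (g : ℕ → ENNReal) :
    ∫⁻ k, g k ∂binomialMeasure n p =
      ∑ k ∈ Finset.range (n + 1), ENNReal.ofReal (binomialWeight p n k) * g k := by
  simp [binomialMeasure, binomialWeight, lintegral_finsetSum_measure]

theorem measurable_trieStep (n : ℕ) : Measurable (trieStep n) := by
  refine measurable_from_prod_countable_right fun k => ?_
  have hleft : Measurable fun y : (ℕ → ℕ × ℕ) × (ℕ → ℕ × ℕ) => y.1 k := by fun_prop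
  have hright : Measurable fun y : (ℕ → ℕ × ℕ) × (ℕ → ℕ × ℕ) => y.2 (n - k) := by fun_prop
  exact ((hleft.fst.add hright.fst).add_const 1).prodMk ((hleft.snd.add hright.snd).add_const n)

theorem IsTriePairFamily.lintegral_snd_ne_top {p : ℝ} {μ : ℕ → Measure (ℕ × ℕ)}
    (hμ : IsTriePairFamily p μ) (n : ℕ) : ∫⁻ x, (x.2 : ENNReal) ∂μ n ≠ ⊤ := by
  have h1 := (hμ.moments n 1).lintegral_lt_top
  refine ne_top_of_le_ne_top h1.ne (lintegral_mono fun x => ?_)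
  rw [pow_one, ENNReal.ofReal_add (by positivity) (by positivity)]
  simp

theorem eK_eq_toReal (μ : ℕ → Measure (ℕ × ℕ)) (n : ℕ) :
    eK μ n = (∫⁻ x, (x.2 : ENNReal) ∂μ n).toReal := by
  unfold eK
  rw [integral_eq_lintegral_of_nonneg_ae (Eventually.of_forall fun x => by positivity)
    (by fun_prop)]
  simp

theorem IsTriePairFamily.lintegral_snd_recurrence {p : ℝ} {μ : ℕ → Measure (ℕ × ℕ)}
    (hμ : IsTriePairFamily p μ) {n : ℕ} (hn : 2 ≤ n) :
    ∫⁻ x, (x.2 : ENNReal) ∂μ n = ∑ k ∈ Finset.range (n + 1),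
      ENNReal.ofReal (binomialWeight p n k) *
        (∫⁻ x, (x.2 : ENNReal) ∂μ k + ∫⁻ x, (x.2 : ENNReal) ∂μ (n - k) + n) := by
  obtain ⟨P, hP, hfst, hleft, hright, hprod, hlaw⟩ := hμ.recur n hn
  set R := (P.map (fun ω => ω.2.1)).prod (P.map (fun ω => ω.2.2)) with hR
  have : IsProbabilityMeasure (P.map Prod.fst) := Measure.isProbabilityMeasure_map (by fun_prop)
  have : IsProbabilityMeasure (P.map (fun ω => ω.2.1)) :=
    Measure.isProbabilityMeasure_map (by fun_prop)
  have : IsProbabilityMeasure (P.map (fun ω => ω.2.2)) :=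
    Measure.isProbabilityMeasure_map (by fun_prop)
  have hRsnd : P.map Prod.snd = R := by
    conv_lhs => rw [hprod]
    rw [Measure.map_snd_prod]
    simp
  have hRleft (j : ℕ) : R.map (fun y => y.1 j) = μ j := by
    rw [← hRsnd, Measure.map_map (by fun_prop) (by fun_prop), ← hleft j]
    rfl
  have hRright (j : ℕ) : R.map (fun y => y.2 j) = μ j := by
    rw [← hRsnd, Measure.map_map (by fun_prop) (by fun_prop), ← hright j]
    rfl
  have hmeas : Measurable fun x : ℕ × ℕ => (x.2 : ENNReal) := by fun_prop
  have hstep : Measurable fun ω => ((trieStep n ω).2 : ENNReal) :=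
    hmeas.comp (measurable_trieStep n)
  rw [hlaw, lintegral_map hmeas (measurable_trieStep n), hprod,
    lintegral_prod _ hstep.aemeasurable, hfst, lintegral_binomialMeasure]
  refine Finset.sum_congr rfl fun k _ => ?_
  congr 1
  simp only [trieStep, Nat.cast_add]
  rw [lintegral_add_right _ measurable_const, lintegral_add_left (by fun_prop),
    ← hRleft k, ← hRright (n - k), lintegral_map hmeas (by fun_prop),
    lintegral_map hmeas (by fun_prop)]
  simp

theorem sum_binomialWeight (p : ℝ) (n : ℕ) :
    ∑ k ∈ Finset.range (n + 1), binomialWeight p n k = 1 := by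
  have := add_pow p (1 - p) n
  simp only [add_sub_cancel, one_pow] at this
  rw [this]
  refine Finset.sum_congr rfl fun k _ => ?_
  unfold binomialWeight
  ring

theorem IsTriePairFamily.eK_recurrence {p : ℝ} (hp0 : 0 ≤ p) (hp1 : p ≤ 1)
    {μ : ℕ → Measure (ℕ × ℕ)} (hμ : IsTriePairFamily p μ) {n : ℕ} (hn : 2 ≤ n) :
    eK μ n = n + ∑ k ∈ Finset.range (n + 1),
      binomialWeight p n k * (eK μ k + eK μ (n - k)) := by
  have hfin := hμ.lintegral_snd_ne_top
  rw [eK_eq_toReal, hμ.lintegral_snd_recurrence hn, ENNReal.toReal_sum]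
  · have key (k : ℕ) : (ENNReal.ofReal (binomialWeight p n k) *
        (∫⁻ x, (x.2 : ENNReal) ∂μ k + ∫⁻ x, (x.2 : ENNReal) ∂μ (n - k) + n)).toReal =
        binomialWeight p n k * (eK μ k + eK μ (n - k)) + binomialWeight p n k * n := by
      rw [ENNReal.toReal_mul, ENNReal.toReal_ofReal (binomialWeight_nonneg hp0 hp1 n k),
        ENNReal.toReal_add (by simp [hfin]) (by simp), ENNReal.toReal_add (hfin _) (hfin _),
        ← eK_eq_toReal, ← eK_eq_toReal, ENNReal.toReal_natCast]
      ring
    simp only [key]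
    rw [Finset.sum_add_distrib, ← Finset.sum_mul, sum_binomialWeight]
    ring
  · intro k _
    exact ENNReal.mul_ne_top ENNReal.ofReal_ne_top (by simp [hfin])

theorem sum_binomialWeight_reflect (p : ℝ) (n : ℕ) (g : ℕ → ℝ) :
    ∑ k ∈ Finset.range (n + 1), binomialWeight p n k * g (n - k) =
      ∑ k ∈ Finset.range (n + 1), binomialWeight (1 - p) n k * g k := by
  rw [← Finset.sum_range_reflect]
  refine Finset.sum_congr rfl fun k hk => ?_
  have hk : k ≤ n := Nat.lt_succ_iff.mp (Finset.mem_range.mp hk)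
  have h1 : n + 1 - 1 - k = n - k := by omega
  have h2 : n - (n - k) = k := by omega
  rw [h1, h2]
  unfold binomialWeight
  rw [h2, Nat.choose_symm hk]
  ring

theorem sum_binomialWeight_mul_cast (p : ℝ) (n : ℕ) :
    ∑ k ∈ Finset.range (n + 1), binomialWeight p n k * k = n * p := by
  have h := congrArg (Polynomial.eval p) (bernsteinPolynomial.sum_smul ℝ n)
  simp only [Polynomial.eval_finsetSum, bernsteinPolynomial, nsmul_eq_mul, Polynomial.eval_mul,
    Polynomial.eval_natCast, Polynomial.eval_pow, Polynomial.eval_sub, Polynomial.eval_X,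
    Polynomial.eval_one] at h
  rw [← h]
  refine Finset.sum_congr rfl fun k _ => ?_
  unfold binomialWeight
  ring

theorem sum_binomialWeight_mul_sub (p : ℝ) (n : ℕ) :
    ∑ k ∈ Finset.range (n + 1), binomialWeight p n k * (k - n * p) = 0 := by
  simp only [mul_sub]
  rw [Finset.sum_sub_distrib, ← Finset.sum_mul, sum_binomialWeight, sum_binomialWeight_mul_cast]
  ring

theorem sum_binomialWeight_mul_sq_sub (p : ℝ) (n : ℕ) :
    ∑ k ∈ Finset.range (n + 1), binomialWeight p n k * (k - n * p) ^ 2 = n * p * (1 - p) := by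
  have h := congrArg (Polynomial.eval p) (bernsteinPolynomial.variance ℝ n)
  simp only [Polynomial.eval_finsetSum, bernsteinPolynomial, nsmul_eq_mul, Polynomial.eval_mul,
    Polynomial.eval_natCast, Polynomial.eval_pow, Polynomial.eval_sub, Polynomial.eval_X,
    Polynomial.eval_one] at h
  rw [← h]
  refine Finset.sum_congr rfl fun k _ => ?_
  unfold binomialWeight
  ring

theorem mul_log_add_sub_le {m x : ℝ} (hm : 0 < m) (hx : 0 ≤ x) :
    x * Real.log m + (x - m) ≤ x * Real.log x := by
  rcases hx.eq_or_lt with rfl | hx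
  · simpa using hm.le
  · have h := Real.one_sub_inv_le_log_of_pos (div_pos hx hm)
    rw [Real.log_div hx.ne' hm.ne', inv_div] at h
    have h2 := mul_le_mul_of_nonneg_left h hx.le
    have h3 : x * (1 - m / x) = x - m := by field_simp
    linarith

theorem mul_log_le_add_sq_div {m x : ℝ} (hm : 0 < m) (hx : 0 ≤ x) :
    x * Real.log x ≤ x * Real.log m + (x - m) + (x - m) ^ 2 / m := by
  rcases hx.eq_or_lt with rfl | hx
  · field_simp
    simp [sq]
  · have h := Real.log_le_sub_one_of_pos (div_pos hx hm)
    rw [Real.log_div hx.ne' hm.ne'] at h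
    have h2 := mul_le_mul_of_nonneg_left h hx.le
    have h3 : x * (x / m - 1) = (x - m) + (x - m) ^ 2 / m := by field_simp; ring
    linarith

theorem mul_log_le_sum_binomialWeight {p : ℝ} (hp0 : 0 < p) (hp1 : p ≤ 1) {n : ℕ} (hn : 0 < n) :
    n * p * Real.log (n * p) ≤
      ∑ k ∈ Finset.range (n + 1), binomialWeight p n k * (k * Real.log k) := by
  have hm : (0 : ℝ) < n * p := by positivity
  calc n * p * Real.log (n * p)
      = ∑ k ∈ Finset.range (n + 1),
          binomialWeight p n k * (k * Real.log (n * p) + (k - n * p)) := by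
        simp only [mul_add, ← mul_assoc]
        rw [Finset.sum_add_distrib, ← Finset.sum_mul, sum_binomialWeight_mul_cast,
          sum_binomialWeight_mul_sub, add_zero]
    _ ≤ _ := Finset.sum_le_sum fun k _ => mul_le_mul_of_nonneg_left
        (mul_log_add_sub_le hm k.cast_nonneg) (binomialWeight_nonneg hp0.le hp1 n k)

theorem sum_binomialWeight_mul_log_le {p : ℝ} (hp0 : 0 < p) (hp1 : p ≤ 1) {n : ℕ} (hn : 0 < n) :
    ∑ k ∈ Finset.range (n + 1), binomialWeight p n k * (k * Real.log k) ≤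
      n * p * Real.log (n * p) + (1 - p) := by
  have hm : (0 : ℝ) < n * p := by positivity
  calc _ ≤ ∑ k ∈ Finset.range (n + 1), binomialWeight p n k *
          (k * Real.log (n * p) + (k - n * p) + (k - n * p) ^ 2 / (n * p)) :=
        Finset.sum_le_sum fun k _ => mul_le_mul_of_nonneg_left
          (mul_log_le_add_sq_div hm k.cast_nonneg) (binomialWeight_nonneg hp0.le hp1 n k)
    _ = n * p * Real.log (n * p) + (1 - p) := by
        simp only [mul_add, ← mul_assoc, ← mul_div_assoc]
        rw [Finset.sum_add_distrib, Finset.sum_add_distrib, ← Finset.sum_mul, ← Finset.sum_div,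
          sum_binomialWeight_mul_cast, sum_binomialWeight_mul_sub, sum_binomialWeight_mul_sq_sub]
        field_simp
        ring

theorem sum_binomialWeight_mul_pred (p : ℝ) (n : ℕ) :
    ∑ k ∈ Finset.range (n + 1), binomialWeight p n k * ((k - 1 : ℕ) : ℝ) =
      n * p - 1 + (1 - p) ^ n := by
  have hpred (k : ℕ) : ((k - 1 : ℕ) : ℝ) = k - 1 + if k = 0 then 1 else 0 := by
    cases k <;> simp
  simp only [hpred, mul_add, mul_sub, mul_one, mul_ite, mul_zero]
  rw [Finset.sum_add_distrib, Finset.sum_sub_distrib, sum_binomialWeight_mul_cast,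
    sum_binomialWeight, Finset.sum_ite_eq']
  simp [binomialWeight]

theorem pow_add_one_sub_pow_le {p : ℝ} (hp0 : 0 < p) (hp1 : p < 1) {n : ℕ} (hn : 2 ≤ n) :
    p ^ n + (1 - p) ^ n ≤ 1 - 2 * p * (1 - p) := by
  have h1 := pow_le_pow_of_le_one hp0.le hp1.le hn
  have h2 := pow_le_pow_of_le_one (by linarith : 0 ≤ 1 - p) (by linarith) hn
  nlinarith

/-- A solution of the trie recurrence with bounded toll grows at most linearly. -/
theorem abs_le_of_trie_recurrence {p : ℝ} (hp0 : 0 < p) (hp1 : p < 1) {a t : ℕ → ℝ} {R : ℝ}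
    (ha0 : a 0 = 0) (ha1 : a 1 = 0) (ht : ∀ n, 2 ≤ n → |t n| ≤ R)
    (hrec : ∀ n, 2 ≤ n → a n = t n + ∑ k ∈ Finset.range (n + 1),
      binomialWeight p n k * (a k + a (n - k))) (n : ℕ) :
    |a n| ≤ R / (2 * p * (1 - p)) * n := by
  have hq0 : 0 < 1 - p := by linarith
  have hR : 0 ≤ R := (abs_nonneg _).trans (ht 2 le_rfl)
  set C := R / (2 * p * (1 - p)) with hC
  have hC0 : 0 ≤ C := by positivity
  have hCR : C * (2 * p * (1 - p)) = R := by rw [hC]; field_simp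
  set b : ℕ → ℝ := fun k => |a k| - C * ((k - 1 : ℕ) : ℝ) with hb
  have hb_nonpos : ∀ m, b m ≤ 0 := by
    intro m
    induction m using Nat.strong_induction_on with
    | _ m ih =>
      rcases lt_or_ge m 2 with hm | hm
      · interval_cases m <;> simp [hb, ha0, ha1]
      have hsum (r : ℝ) (hr0 : 0 ≤ r) (hr1 : r ≤ 1) :
          ∑ k ∈ Finset.range (m + 1), binomialWeight r m k * b k ≤ r ^ m * b m := by
        rw [Finset.sum_range_succ]
        have h1 : ∑ k ∈ Finset.range m, binomialWeight r m k * b k ≤ 0 :=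
          Finset.sum_nonpos fun k hk => mul_nonpos_of_nonneg_of_nonpos
            (binomialWeight_nonneg hr0 hr1 m k) (ih k (Finset.mem_range.mp hk))
        have h2 : binomialWeight r m m = r ^ m := by simp [binomialWeight]
        rw [h2]
        linarith
      have hsplit (g : ℕ → ℝ) : ∑ k ∈ Finset.range (m + 1),
          binomialWeight p m k * (g k + g (m - k)) =
          ∑ k ∈ Finset.range (m + 1), binomialWeight p m k * g k +
          ∑ k ∈ Finset.range (m + 1), binomialWeight (1 - p) m k * g k := by
        rw [← sum_binomialWeight_reflect, ← Finset.sum_add_distrib]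
        simp only [mul_add]
      have habs : |a m| ≤ R + ∑ k ∈ Finset.range (m + 1),
          binomialWeight p m k * (|a k| + |a (m - k)|) := by
        rw [hrec m hm]
        refine (abs_add_le _ _).trans (add_le_add (ht m hm) ?_)
        refine (Finset.abs_sum_le_sum_abs _ _).trans (Finset.sum_le_sum fun k _ => ?_)
        rw [abs_mul, abs_of_nonneg (binomialWeight_nonneg hp0.le hp1.le m k)]
        exact mul_le_mul_of_nonneg_left (abs_add_le _ _) (binomialWeight_nonneg hp0.le hp1.le m k)
      have hdecomp (r : ℝ) : ∑ k ∈ Finset.range (m + 1), binomialWeight r m k * b k =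
          ∑ k ∈ Finset.range (m + 1), binomialWeight r m k * |a k| -
            C * (m * r - 1 + (1 - r) ^ m) := by
        rw [← sum_binomialWeight_mul_pred, Finset.mul_sum, ← Finset.sum_sub_distrib]
        exact Finset.sum_congr rfl fun k _ => by simp only [hb]; ring
      have hp := hsum p hp0.le hp1.le
      have hq := hsum (1 - p) hq0.le (by linarith)
      rw [hdecomp] at hp hq
      rw [hsplit fun k => |a k|] at habs
      have hpow := pow_add_one_sub_pow_le hp0 hp1 hm
      have hbm : b m = |a m| - C * (m - 1) := by
        simp only [hb]
        rw [Nat.cast_sub (by omega)]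
        simp
      have hle : b m ≤ (p ^ m + (1 - p) ^ m) * b m := by
        have hslack := mul_le_mul_of_nonneg_left hpow hC0
        rw [sub_sub_cancel] at hq
        linarith
      have hpos : 0 < 2 * p * (1 - p) := by positivity
      nlinarith
  have h1 := hb_nonpos n
  have h2 : ((n - 1 : ℕ) : ℝ) ≤ n := by exact_mod_cast Nat.sub_le n 1
  have h3 := mul_le_mul_of_nonneg_left h2 hC0
  simp only [hb] at h1
  linarith

theorem entropy_pos {p : ℝ} (hp0 : 0 < p) (hp1 : p < 1) :
    0 < -(p * Real.log p) - (1 - p) * Real.log (1 - p) := by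
  have h1 := mul_neg_of_pos_of_neg hp0 (Real.log_neg hp0 hp1)
  have h2 := mul_neg_of_pos_of_neg (by linarith : 0 < 1 - p)
    (Real.log_neg (by linarith) (by linarith : 1 - p < 1))
  linarith

theorem IsTriePairFamily.exists_abs_eK_sub_le {p : ℝ} (hp0 : 0 < p) (hp1 : p < 1)
    {μ : ℕ → Measure (ℕ × ℕ)} (hμ : IsTriePairFamily p μ) {h : ℝ}
    (hh : h = -(p * Real.log p) - (1 - p) * Real.log (1 - p)) :
    ∃ C : ℝ, ∀ n : ℕ, |eK μ n - n * Real.log n / h| ≤ C * n := by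
  have hh0 : 0 < h := hh ▸ entropy_pos hp0 hp1
  have hq0 : 0 < 1 - p := by linarith
  set g : ℕ → ℝ := fun n => n * Real.log n with hg
  refine ⟨_, abs_le_of_trie_recurrence hp0 hp1 (R := 1 / h)
    (t := fun n => n + (∑ k ∈ Finset.range (n + 1),
      binomialWeight p n k * (g k + g (n - k)) - g n) / h) ?_ ?_ ?_ ?_⟩
  · simp [eK, hμ.init0]
  · simp [eK, hμ.init1]
  · intro n hn
    have hn0 : 0 < n := by omega
    have hn0' : (n : ℝ) ≠ 0 := by positivity
    have hsplit : ∑ k ∈ Finset.range (n + 1), binomialWeight p n k * (g k + g (n - k)) =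
        ∑ k ∈ Finset.range (n + 1), binomialWeight p n k * g k +
        ∑ k ∈ Finset.range (n + 1), binomialWeight (1 - p) n k * g k := by
      rw [← sum_binomialWeight_reflect, ← Finset.sum_add_distrib]
      simp only [mul_add]
    have hpl := mul_log_le_sum_binomialWeight hp0 hp1.le hn0
    have hpu := sum_binomialWeight_mul_log_le hp0 hp1.le hn0
    have hql := mul_log_le_sum_binomialWeight hq0 (by linarith) hn0
    have hqu := sum_binomialWeight_mul_log_le hq0 (by linarith) hn0
    rw [Real.log_mul hn0' hp0.ne'] at hpl hpu
    rw [Real.log_mul hn0' hq0.ne'] at hql hqu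
    have hnh : (n : ℝ) * h = -(n * p * Real.log p) - n * (1 - p) * Real.log (1 - p) := by
      rw [hh]; ring
    have htoll : (n : ℝ) + (∑ k ∈ Finset.range (n + 1),
        binomialWeight p n k * (g k + g (n - k)) - g n) / h =
        (n * h + (∑ k ∈ Finset.range (n + 1), binomialWeight p n k * g k +
          ∑ k ∈ Finset.range (n + 1), binomialWeight (1 - p) n k * g k - g n)) / h := by
      rw [hsplit]
      field_simp
    have hgn : g n = n * Real.log n := rfl
    rw [htoll, abs_div, abs_of_pos hh0]
    refine div_le_div_of_nonneg_right (abs_le.mpr ⟨?_, ?_⟩) hh0.le <;> rw [hgn, hnh] <;> linarith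
  · intro n hn
    rw [hμ.eK_recurrence hp0.le hp1.le hn, sub_div, Finset.sum_div, ← sub_eq_zero]
    have : ∑ k ∈ Finset.range (n + 1), binomialWeight p n k * (eK μ k + eK μ (n - k)) =
        ∑ k ∈ Finset.range (n + 1), binomialWeight p n k *
          (eK μ k - k * Real.log k / h +
            (eK μ (n - k) - ((n - k : ℕ) : ℝ) * Real.log ((n - k : ℕ) : ℝ) / h)) +
        ∑ k ∈ Finset.range (n + 1), binomialWeight p n k * (g k + g (n - k)) / h := by
      rw [← Finset.sum_add_distrib]
      exact Finset.sum_congr rfl fun k _ => by simp only [hg]; ring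
    rw [this]
    ring

theorem hasSum_of_forall_eq {f g : ℕ → ℝ} {a b : ℝ} (hf : HasSum f a) (hfg : ∀ n, g n = f n)
    (hab : b = a) : HasSum g b := by
  rw [hab, funext hfg]
  exact hf

theorem hasSum_poisson {x : ℝ} (hx : 0 ≤ x) :
    HasSum (fun n : ℕ => Real.exp (-x) * x ^ n / n.factorial) 1 :=
  hasSum_one_poissonMeasure ⟨x, hx⟩

theorem hasSum_poisson_mul_cast {x : ℝ} (hx : 0 ≤ x) :
    HasSum (fun n : ℕ => Real.exp (-x) * x ^ n / n.factorial * n) x := by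
  rw [← hasSum_nat_add_iff' 1]
  refine hasSum_of_forall_eq ((hasSum_poisson hx).mul_left x) (fun n => ?_) ?_
  · rw [Nat.factorial_succ]
    push_cast
    field_simp
    ring
  · simp

theorem hasSum_poisson_mul_descFactorial {x : ℝ} (hx : 0 ≤ x) :
    HasSum (fun n : ℕ => Real.exp (-x) * x ^ n / n.factorial * (n * (n - 1))) (x ^ 2) := by
  rw [← hasSum_nat_add_iff' 1]
  refine hasSum_of_forall_eq ((hasSum_poisson_mul_cast hx).mul_left x) (fun n => ?_) ?_
  · rw [Nat.factorial_succ]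
    push_cast
    field_simp
    ring
  · simp [sq]

theorem hasSum_poisson_mul_sub {x : ℝ} (hx : 0 ≤ x) :
    HasSum (fun n : ℕ => Real.exp (-x) * x ^ n / n.factorial * (n - x)) 0 := by
  refine hasSum_of_forall_eq ((hasSum_poisson_mul_cast hx).sub
    ((hasSum_poisson hx).mul_right x)) (fun n => ?_) ?_
  · ring
  · ring

theorem hasSum_poisson_mul_sq_sub {x : ℝ} (hx : 0 ≤ x) :
    HasSum (fun n : ℕ => Real.exp (-x) * x ^ n / n.factorial * (n - x) ^ 2) x := by
  refine hasSum_of_forall_eq (((hasSum_poisson_mul_descFactorial hx).add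
    ((hasSum_poisson_mul_cast hx).mul_right (1 - 2 * x))).add
    ((hasSum_poisson hx).mul_right (x ^ 2))) (fun n => ?_) ?_
  · ring
  · ring

theorem abs_tsum_poisson_sub_le {e : ℕ → ℝ} {h C x : ℝ} (hh : 0 < h) (hx : 0 < x)
    (he0 : ∀ n, 0 ≤ e n) (he : ∀ n : ℕ, |e n - n * Real.log n / h| ≤ C * n) :
    |∑' n : ℕ, Real.exp (-x) * x ^ n / n.factorial * e n - x * Real.log x / h| ≤
      C * x + 1 / h := by
  have hw (n : ℕ) : 0 ≤ Real.exp (-x) * x ^ n / n.factorial := by positivity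
  have hlower : HasSum (fun n : ℕ => Real.exp (-x) * x ^ n / n.factorial *
      ((n * Real.log x + (n - x)) / h - C * n)) (x * Real.log x / h - C * x) := by
    refine hasSum_of_forall_eq (((hasSum_poisson_mul_cast hx.le).mul_right (Real.log x / h - C)).add
      ((hasSum_poisson_mul_sub hx.le).mul_right (1 / h))) (fun n => ?_) ?_
    · ring
    · ring
  have hupper : HasSum (fun n : ℕ => Real.exp (-x) * x ^ n / n.factorial *
      ((n * Real.log x + (n - x) + (n - x) ^ 2 / x) / h + C * n))
      (x * Real.log x / h + 1 / h + C * x) := by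
    refine hasSum_of_forall_eq ((((hasSum_poisson_mul_cast hx.le).mul_right (Real.log x / h + C)).add
      ((hasSum_poisson_mul_sub hx.le).mul_right (1 / h))).add
      ((hasSum_poisson_mul_sq_sub hx.le).mul_right (1 / (x * h)))) (fun n => ?_) ?_
    · field_simp; ring
    · field_simp; ring
  have hle_upper (n : ℕ) : Real.exp (-x) * x ^ n / n.factorial * e n ≤
      Real.exp (-x) * x ^ n / n.factorial *
        ((n * Real.log x + (n - x) + (n - x) ^ 2 / x) / h + C * n) := by
    refine mul_le_mul_of_nonneg_left ?_ (hw n)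
    have h1 := div_le_div_of_nonneg_right (mul_log_le_add_sq_div hx n.cast_nonneg) hh.le
    linarith [(abs_le.mp (he n)).2]
  have hlower_le (n : ℕ) : Real.exp (-x) * x ^ n / n.factorial *
      ((n * Real.log x + (n - x)) / h - C * n) ≤
      Real.exp (-x) * x ^ n / n.factorial * e n := by
    refine mul_le_mul_of_nonneg_left ?_ (hw n)
    have h1 := div_le_div_of_nonneg_right (mul_log_add_sub_le hx n.cast_nonneg) hh.le
    linarith [(abs_le.mp (he n)).1]
  have hsum : Summable fun n : ℕ => Real.exp (-x) * x ^ n / n.factorial * e n :=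
    hupper.summable.of_nonneg_of_le (fun n => mul_nonneg (hw n) (he0 n)) hle_upper
  have h1 := hasSum_le hle_upper hsum.hasSum hupper
  have h2 := hasSum_le hlower_le hlower hsum.hasSum
  have h3 : 0 < 1 / h := by positivity
  rw [abs_le]
  constructor <;> linarith

theorem tendsto_div_mul_log {ι : Type*} {l : Filter ι} {u F : ι → ℝ} {h C D : ℝ}
    (hu : Tendsto u l atTop)
    (hF : ∀ᶠ i in l, |F i - u i * Real.log (u i) / h| ≤ C * u i + D) :
    Tendsto (fun i => F i / (u i * Real.log (u i))) l (𝓝 (1 / h)) := by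
  have hlog : Tendsto (fun i => Real.log (u i)) l atTop := Real.tendsto_log_atTop.comp hu
  have hbound : Tendsto (fun i => C * (Real.log (u i))⁻¹ + D * (u i * Real.log (u i))⁻¹) l
      (𝓝 0) := by
    simpa using (hlog.inv_tendsto_atTop.const_mul C).add
      ((hu.atTop_mul_atTop₀ hlog).inv_tendsto_atTop.const_mul D)
  rw [tendsto_iff_norm_sub_tendsto_zero]
  refine squeeze_zero' (Eventually.of_forall fun _ => norm_nonneg _) ?_ hbound
  filter_upwards [hF, hu.eventually_gt_atTop 0, hlog.eventually_gt_atTop 0] with i hi hu0 hl0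
  have hpos : 0 < u i * Real.log (u i) := mul_pos hu0 hl0
  have h1 : F i / (u i * Real.log (u i)) - 1 / h =
      (F i - u i * Real.log (u i) / h) / (u i * Real.log (u i)) := by
    rw [sub_div, div_right_comm, div_self hpos.ne']
  have h2 : C * (Real.log (u i))⁻¹ + D * (u i * Real.log (u i))⁻¹ =
      (C * u i + D) / (u i * Real.log (u i)) := by
    field_simp
  rw [h1, h2, Real.norm_eq_abs, abs_div, abs_of_pos hpos]
  exact div_le_div_of_nonneg_right hi hpos.le

/-- `f̃₀₁(x) ~ x log x / h` along the positive reals and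
`E(K_n) ~ n log n / h`. -/
theorem stmt18 (p : ℝ) (hp0 : 0 < p) (hp1 : p < 1) (q : ℝ) (hq : q = 1 - p)
    (h : ℝ) (hh : h = -(p * Real.log p) - q * Real.log q)
    (μ : ℕ → Measure (ℕ × ℕ)) (hμ : IsTriePairFamily p μ)
    (f : ℝ → ℝ)
    (hf : ∀ x : ℝ, f x = Real.exp (-x) * ∑' n : ℕ, eK μ n * x ^ n / (n.factorial : ℝ)) :
    Tendsto (fun x : ℝ => f x / (x * Real.log x)) atTop (𝓝 (1 / h)) ∧
    Tendsto (fun n : ℕ => eK μ n / ((n : ℝ) * Real.log n)) atTop (𝓝 (1 / h)) := by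
  subst hq
  have hh0 : 0 < h := hh ▸ entropy_pos hp0 hp1
  obtain ⟨C, hC⟩ := hμ.exists_abs_eK_sub_le hp0 hp1 hh
  have hK0 (n : ℕ) : 0 ≤ eK μ n := integral_nonneg fun x => Nat.cast_nonneg x.2
  refine ⟨tendsto_div_mul_log (C := C) (D := 1 / h) tendsto_id ?_,
    tendsto_div_mul_log (C := C) (D := 0) tendsto_natCast_atTop_atTop ?_⟩
  · filter_upwards [eventually_gt_atTop 0] with x hx
    have hfx : f x = ∑' n : ℕ, Real.exp (-x) * x ^ n / n.factorial * eK μ n := by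
      rw [hf, ← tsum_mul_left]
      exact tsum_congr fun n => by ring
    rw [hfx]
    exact abs_tsum_poisson_sub_le hh0 hx hK0 hC
  · exact Eventually.of_forall fun n => by simpa using hC n
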